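/- arXiv:math/0503299 — 6 statements merged into one kernel-verified Lean document; each statement's English description precedes it below -/
import Mathlib

section
/- Let n ≥ 2 be even and let W be an irreducible complex Clifford module. If T : W → W is a ℂ-linear map satisfying T(v·ψ) = -v·T(ψ) for all v ∈ ℝⁿ and ψ ∈ W, then there exists c ∈ ℂ such that T = c·γ(ω). -/
/-- Moving `e j` past a word in pairwise anticommuting letters costs one sign for each letter
different from `e j`. -/
theorem mul_prod_map_of_anticommute {ι A : Type*} [DecidableEq ι] [Ring A] {e : ι → A}
    (he : Pairwise fun i j => e i * e j = -(e j * e i)) (j : ι) (l : List ι) :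
    e j * (l.map e).prod = (-1) ^ (l.length + l.count j) * ((l.map e).prod * e j) := by
  induction l with
  | nil => simp
  | cons a l ih =>
    rw [List.map_cons, List.prod_cons, List.length_cons, List.count_cons]
    by_cases h : a = j
    · subst h
      rw [mul_assoc (e a), ih, ← mul_assoc, ← mul_assoc (e a),
        ← ((Commute.neg_one_left (e a)).pow_left _).eq]
      simp [pow_add, mul_assoc]
    · rw [← mul_assoc, he (Ne.symm h), neg_mul, mul_assoc, ih, ← mul_assoc,
        ← ((Commute.neg_one_left (e a)).pow_left _).eq]
      simp [h, pow_add, mul_assoc]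

/-- Schur's lemma: an endomorphism commuting with a family of operators that has no nontrivial
common invariant subspace is a scalar. -/
theorem exists_eq_smul_one_of_commute {K W V : Type*} [Field K] [IsAlgClosed K] [AddCommGroup W]
    [Module K W] [FiniteDimensional K W] [Nontrivial W] (ρ : V → Module.End K W)
    (hirr : ∀ U : Submodule K W, (∀ v, ∀ ψ ∈ U, ρ v ψ ∈ U) → U = ⊥ ∨ U = ⊤)
    (S : Module.End K W) (hS : ∀ v, Commute S (ρ v)) : ∃ c : K, S = c • 1 := by
  obtain ⟨c, hc⟩ := Module.End.exists_eigenvalue S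
  refine ⟨c, ?_⟩
  have hinv (v : V) (ψ : W) (hψ : ψ ∈ S.eigenspace c) : ρ v ψ ∈ S.eigenspace c := by
    rw [Module.End.mem_eigenspace_iff] at hψ ⊢
    rw [← Module.End.mul_apply, (hS v).eq, Module.End.mul_apply, hψ, map_smul]
  rcases hirr (S.eigenspace c) hinv with h | h
  · exact absurd h hc
  · ext ψ
    have hψ : ψ ∈ S.eigenspace c := h ▸ Submodule.mem_top
    simpa using Module.End.mem_eigenspace_iff.mp hψ

section VolumeElement

variable {n : ℕ} {Q : QuadraticForm ℝ (EuclideanSpace ℝ (Fin n))}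

theorem ι_single_anticommute (hQ : ∀ v, Q v = -‖v‖ ^ 2) :
    Pairwise fun i j : Fin n =>
      CliffordAlgebra.ι Q (EuclideanSpace.single i (1 : ℝ)) *
        CliffordAlgebra.ι Q (EuclideanSpace.single j (1 : ℝ)) =
      -(CliffordAlgebra.ι Q (EuclideanSpace.single j (1 : ℝ)) *
        CliffordAlgebra.ι Q (EuclideanSpace.single i (1 : ℝ))) := by
  intro i j hij
  apply CliffordAlgebra.ι_mul_ι_comm_of_isOrtho
  rw [QuadraticMap.isOrtho_def, hQ, hQ, hQ, norm_add_sq_real]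
  simp [EuclideanSpace.inner_single_left, hij]

theorem ι_mul_volume (hQ : ∀ v, Q v = -‖v‖ ^ 2) (heven : Even n)
    (v : EuclideanSpace ℝ (Fin n)) :
    CliffordAlgebra.ι Q v * (List.ofFn fun i : Fin n =>
      CliffordAlgebra.ι Q (EuclideanSpace.single i (1 : ℝ))).prod =
    -((List.ofFn fun i : Fin n =>
      CliffordAlgebra.ι Q (EuclideanSpace.single i (1 : ℝ))).prod * CliffordAlgebra.ι Q v) := by
  set ω := (List.ofFn fun i : Fin n =>
      CliffordAlgebra.ι Q (EuclideanSpace.single i (1 : ℝ))).prod with hω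
  have h : LinearMap.mulRight ℝ ω ∘ₗ CliffordAlgebra.ι Q =
      -(LinearMap.mulLeft ℝ ω ∘ₗ CliffordAlgebra.ι Q) := by
    refine (EuclideanSpace.basisFun (Fin n) ℝ).toBasis.ext fun j => ?_
    have := mul_prod_map_of_anticommute (ι_single_anticommute hQ) j (List.finRange n)
    rw [← List.ofFn_eq_map, ← hω, List.length_finRange,
      List.count_eq_one_of_mem (List.nodup_finRange n) (List.mem_finRange j),
      heven.add_one.neg_one_pow] at this
    simpa using this
  simpa using LinearMap.congr_fun h v

theorem isUnit_volume (hQ : ∀ v, Q v = -‖v‖ ^ 2) :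
    IsUnit (List.ofFn fun i : Fin n =>
      CliffordAlgebra.ι Q (EuclideanSpace.single i (1 : ℝ))).prod := by
  refine List.prod_isUnit fun x hx => ?_
  obtain ⟨i, rfl⟩ := (List.mem_ofFn' _ _).mp hx
  apply CliffordAlgebra.isUnit_ι_of_isUnit
  simp [hQ]

end VolumeElement


/-- Let `n ≥ 2` be even and let `W` be an irreducible complex Clifford
module (over the Clifford algebra `Cl_n` of `Q v = -‖v‖²` on `ℝⁿ`).  If `T : W → W` is a
ℂ-linear map satisfying `T(v·ψ) = -v·T(ψ)` for all `v ∈ ℝⁿ` and `ψ ∈ W`, then there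
exists `c ∈ ℂ` such that `T = c·γ(ω)`. -/
theorem stmt_4 (n : ℕ) (hn : 2 ≤ n) (heven : Even n)
    (Q : QuadraticForm ℝ (EuclideanSpace ℝ (Fin n)))
    (hQ : ∀ v : EuclideanSpace ℝ (Fin n), Q v = -‖v‖ ^ 2)
    (W : Type) [AddCommGroup W] [Module ℝ W] [Module ℂ W] [IsScalarTower ℝ ℂ W]
    [FiniteDimensional ℂ W] [Nontrivial W]
    (γ : CliffordAlgebra Q →ₐ[ℝ] Module.End ℂ W)
    (hirr : ∀ U : Submodule ℂ W,
      (∀ (v : EuclideanSpace ℝ (Fin n)), ∀ ψ ∈ U, γ (CliffordAlgebra.ι Q v) ψ ∈ U) →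
      U = ⊥ ∨ U = ⊤)
    (ω : CliffordAlgebra Q)
    (hω : ω = (List.ofFn fun i : Fin n =>
      CliffordAlgebra.ι Q (EuclideanSpace.single i (1 : ℝ))).prod)
    (T : W →ₗ[ℂ] W)
    (hT : ∀ (v : EuclideanSpace ℝ (Fin n)) (ψ : W),
      T (γ (CliffordAlgebra.ι Q v) ψ) = -(γ (CliffordAlgebra.ι Q v) (T ψ))) :
    ∃ c : ℂ, T = c • γ ω := by
  have hanti (v) : γ (CliffordAlgebra.ι Q v) * γ ω = -(γ ω * γ (CliffordAlgebra.ι Q v)) := by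
    rw [← map_mul, ← map_mul, ← map_neg, hω, ι_mul_volume hQ heven]
  have hT' (v) : γ (CliffordAlgebra.ι Q v) * T = -(T * γ (CliffordAlgebra.ι Q v)) := by
    ext ψ
    simp [hT]
  have schur (S : Module.End ℂ W)
      (hS : ∀ v, γ (CliffordAlgebra.ι Q v) * S = -(S * γ (CliffordAlgebra.ι Q v))) :
      ∃ c : ℂ, γ ω * S = c • 1 := by
    refine exists_eq_smul_one_of_commute (fun v => γ (CliffordAlgebra.ι Q v)) hirr _ fun v => ?_
    change _ * _ = _ * _
    rw [← mul_assoc, hanti, neg_mul, mul_assoc _ _ S, hS, mul_neg, neg_neg, mul_assoc]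
  obtain ⟨c, hc⟩ := schur T hT'
  obtain ⟨d, hd⟩ := schur (γ ω) hanti
  have hunit : IsUnit (γ ω) := (hω ▸ isUnit_volume hQ).map γ
  have hd0 : d ≠ 0 := by
    rintro rfl
    exact (hunit.mul hunit).ne_zero (by rw [hd, zero_smul])
  refine ⟨d⁻¹ * c, ?_⟩
  have h : d • T = c • γ ω := by
    calc d • T = γ ω * γ ω * T := by rw [hd, smul_mul_assoc, one_mul]
      _ = c • γ ω := by rw [mul_assoc, hc, mul_smul_comm, mul_one]
  rw [mul_smul, ← h, inv_smul_smul₀ hd0]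
end

section
/- Let n ≡ 1 mod 4 and let W be an irreducible complex Clifford module. Then there exists a bijection ν : W → W which is conjugate-linear (ν(cψ) = c̄·ν(ψ) for all c ∈ ℂ, ψ ∈ W) and anticommutes with Clifford multiplication by vectors: ν(v·ψ) = -v·ν(ψ) for all v ∈ ℝⁿ and ψ ∈ W. -/
section AnticommutingOperators

variable {W : Type*} [AddCommGroup W] [Module ℂ W]

/-- The ordered product `g 0 * g 1 * ⋯ * g (k - 1)`. -/
def orderedProd {R : Type*} [Monoid R] (g : ℕ → R) : ℕ → R
  | 0 => 1
  | k + 1 => orderedProd g k * g k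

theorem mul_orderedProd_of_le {R : Type*} [Ring R] {g : ℕ → R} {n : ℕ}
    (hg : ∀ i < n, ∀ j < n, i ≠ j → g i * g j = -(g j * g i)) {i : ℕ} (hi : i < n) :
    ∀ k ≤ i, g i * orderedProd g k = (-1) ^ k * (orderedProd g k * g i)
  | 0, _ => by simp [orderedProd]
  | k + 1, hk => by
    rw [orderedProd, ← mul_assoc, mul_orderedProd_of_le hg hi k (by omega), mul_assoc, mul_assoc,
      hg i hi k (by omega) (by omega)]
    simp [pow_succ, mul_assoc]

theorem mul_orderedProd_of_lt {R : Type*} [Ring R] {g : ℕ → R} {n : ℕ}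
    (hg : ∀ i < n, ∀ j < n, i ≠ j → g i * g j = -(g j * g i)) {i : ℕ} :
    ∀ k ≤ n, i < k → g i * orderedProd g k = (-1) ^ (k + 1) * (orderedProd g k * g i)
  | 0, _, hik => by omega
  | k + 1, hk, hik => by
    rcases Nat.lt_succ_iff_lt_or_eq.mp hik with h | rfl
    · rw [orderedProd, ← mul_assoc, mul_orderedProd_of_lt hg k (by omega) h, mul_assoc, mul_assoc,
        hg i (by omega) k (by omega) (by omega)]
      simp [pow_succ, mul_assoc]
    · rw [orderedProd, ← mul_assoc, mul_orderedProd_of_le hg (by omega) i le_rfl]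
      simp [pow_succ, mul_assoc]

theorem orderedProd_mul_self {R : Type*} [Ring R] {g : ℕ → R} {n : ℕ}
    (hsq : ∀ i < n, g i * g i = -1)
    (hg : ∀ i < n, ∀ j < n, i ≠ j → g i * g j = -(g j * g i)) :
    ∀ k ≤ n, orderedProd g k * orderedProd g k = (-1) ^ (∑ i ∈ Finset.range (k + 1), i)
  | 0, _ => by simp [orderedProd]
  | k + 1, hk => by
    have h := mul_orderedProd_of_le hg (i := k) (by omega) k le_rfl
    have hc : Commute ((-1 : R) ^ k) (orderedProd g k) := (Commute.neg_one_left _).pow_left k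
    calc orderedProd g (k + 1) * orderedProd g (k + 1)
        = orderedProd g k * (g k * orderedProd g k) * g k := by simp only [orderedProd, mul_assoc]
      _ = (-1) ^ k * (orderedProd g k * orderedProd g k) * (g k * g k) := by
          rw [h, ← mul_assoc, ← hc.eq]; simp only [mul_assoc]
      _ = (-1) ^ (∑ i ∈ Finset.range (k + 1 + 1), i) := by
          rw [orderedProd_mul_self hsq hg k (by omega), hsq k (by omega),
            Finset.sum_range_succ _ (k + 1), ← pow_add, ← pow_succ]
          congr 1
          omega

/-- A map anticommuting with `g i` for `i < k` commutes with their product up to `(-1) ^ k`. -/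
theorem map_orderedProd_apply {g : ℕ → Module.End ℂ W} {A : W →ₛₗ[starRingEnd ℂ] W} :
    ∀ k, (∀ i < k, ∀ x, A (g i x) = -g i (A x)) →
      ∀ x, A (orderedProd g k x) = (-1 : ℂ) ^ k • orderedProd g k (A x)
  | 0, _, x => by simp [orderedProd]
  | k + 1, h, x => by
    rw [orderedProd, Module.End.mul_apply,
      map_orderedProd_apply k (fun i hi => h i (by omega)), h k (by omega)]
    simp [pow_succ]

theorem exists_conjLinear_ne_zero [Nontrivial W] : ∃ A : W →ₛₗ[starRingEnd ℂ] W, A ≠ 0 := by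
  obtain ⟨w, hw⟩ := exists_ne (0 : W)
  obtain ⟨f, hf⟩ := Module.Projective.exists_dual_ne_zero ℂ hw
  let A : W →ₛₗ[starRingEnd ℂ] W :=
    { toFun x := starRingEnd ℂ (f x) • w
      map_add' x y := by simp [add_smul]
      map_smul' c x := by simp [mul_smul] }
  refine ⟨A, fun h => ?_⟩
  have h' : starRingEnd ℂ (f w) • w = 0 := LinearMap.congr_fun h w
  simp [hf, hw] at h'

/-- All but the last of a family of anticommuting complex structures anticommute with a common
nonzero conjugate-linear map. -/
theorem exists_conjLinear_anticomm [Nontrivial W] {g : ℕ → Module.End ℂ W} {n : ℕ}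
    (hsq : ∀ i < n, g i * g i = -1)
    (hg : ∀ i < n, ∀ j < n, i ≠ j → g i * g j = -(g j * g i)) :
    ∀ k < n, ∃ A : W →ₛₗ[starRingEnd ℂ] W, A ≠ 0 ∧ ∀ i < k, ∀ x, A (g i x) = -g i (A x)
  | 0, _ => by
    obtain ⟨A, hA⟩ := exists_conjLinear_ne_zero (W := W)
    exact ⟨A, hA, by simp⟩
  | k + 1, hk => by
    obtain ⟨A, hA, hanti⟩ := exists_conjLinear_anticomm hsq hg k (by omega)
    have sq : ∀ i < n, ∀ x, g i (g i x) = -x := fun i hi x => by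
      simpa using LinearMap.congr_fun (hsq i hi) x
    have swap : ∀ i < n, ∀ j < n, i ≠ j → ∀ x, g i (g j x) = -g j (g i x) :=
      fun i hi j hj hij x => by simpa using LinearMap.congr_fun (hg i hi j hj hij) x
    by_cases hP : A + (g k).comp (A.comp (g k)) = 0
    · have hcomm : ∀ x, A (g k x) = g k (A x) := fun x => by
        have h := LinearMap.congr_fun hP (g k x)
        simp only [LinearMap.add_apply, LinearMap.comp_apply, LinearMap.zero_apply,
          sq k (by omega), map_neg] at h
        exact add_neg_eq_zero.mp h
      refine ⟨A.comp (g k * g (k + 1)), fun h0 => hA ?_, fun i hi x => ?_⟩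
      · ext x
        have h := LinearMap.congr_fun h0 (g (k + 1) (g k x))
        simpa [sq k (by omega), sq (k + 1) hk] using h
      · simp only [LinearMap.comp_apply, Module.End.mul_apply]
        rcases Nat.lt_succ_iff_lt_or_eq.mp hi with h | rfl
        · rw [swap (k + 1) hk i (by omega) (by omega), map_neg, swap k (by omega) i (by omega)
            (by omega), neg_neg, hanti i h]
        · rw [swap (i + 1) hk i (by omega) (by omega), map_neg, map_neg, hcomm]
    · refine ⟨_, hP, fun i hi x => ?_⟩
      simp only [LinearMap.add_apply, LinearMap.comp_apply]
      rcases Nat.lt_succ_iff_lt_or_eq.mp hi with h | rfl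
      · rw [swap k (by omega) i (by omega) (by omega), map_neg, map_neg, hanti i h, hanti i h,
          map_neg, neg_neg, swap k (by omega) i (by omega) (by omega), map_add, neg_add]
      · rw [sq i (by omega), map_neg, map_neg, map_add, sq i (by omega)]
        abel

/-- The product of an odd anticommuting family with no common invariant subspace is a scalar. -/
theorem exists_orderedProd_eq_smul [FiniteDimensional ℂ W] [Nontrivial W]
    {g : ℕ → Module.End ℂ W} {n : ℕ} (hn : Odd n)
    (hg : ∀ i < n, ∀ j < n, i ≠ j → g i * g j = -(g j * g i))
    (hirr : ∀ U : Submodule ℂ W, (∀ i < n, ∀ x ∈ U, g i x ∈ U) → U = ⊥ ∨ U = ⊤) :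
    ∃ c : ℂ, ∀ x, orderedProd g n x = c • x := by
  obtain ⟨c, hc⟩ := Module.End.exists_eigenvalue (orderedProd g n)
  have htop : Module.End.eigenspace (orderedProd g n) c = ⊤ := by
    refine (hirr _ fun i hi x hx => ?_).resolve_left hc
    rw [Module.End.mem_eigenspace_iff] at hx ⊢
    have h := mul_orderedProd_of_lt hg n le_rfl hi
    rw [hn.add_one.neg_one_pow, one_mul] at h
    rw [← Module.End.mul_apply, ← h, Module.End.mul_apply, hx, map_smul]
  exact ⟨c, fun x => Module.End.mem_eigenspace_iff.mp (htop ▸ Submodule.mem_top)⟩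

theorem exists_conjLinear_bijective_anticomm [FiniteDimensional ℂ W] [Nontrivial W]
    {g : ℕ → Module.End ℂ W} {n : ℕ} (hn : n % 4 = 1)
    (hsq : ∀ i < n, g i * g i = -1)
    (hg : ∀ i < n, ∀ j < n, i ≠ j → g i * g j = -(g j * g i))
    (hirr : ∀ U : Submodule ℂ W, (∀ i < n, ∀ x ∈ U, g i x ∈ U) → U = ⊥ ∨ U = ⊤) :
    ∃ A : W →ₛₗ[starRingEnd ℂ] W, Function.Bijective A ∧
      ∀ i < n, ∀ x, A (g i x) = -g i (A x) := by
  obtain ⟨m, rfl⟩ : ∃ m, n = 4 * m + 1 := ⟨n / 4, by omega⟩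
  obtain ⟨A, hA, hanti⟩ := exists_conjLinear_anticomm hsq hg (4 * m) (by omega)
  obtain ⟨c, hc⟩ := exists_orderedProd_eq_smul ⟨2 * m, by ring⟩ hg hirr
  have hp : orderedProd g (4 * m) * orderedProd g (4 * m) = 1 := by
    rw [orderedProd_mul_self hsq hg _ (by omega), Even.neg_one_pow]
    have h := Finset.sum_range_id_mul_two (4 * m + 1)
    exact ⟨m * (4 * m + 1), by simp only [Nat.add_sub_cancel] at h; linarith⟩
  have hlast : ∀ x, g (4 * m) x = c • orderedProd g (4 * m) x := fun x => by
    have h := congrArg (⇑(orderedProd g (4 * m))) (hc x)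
    rwa [orderedProd, ← Module.End.mul_apply, ← mul_assoc, hp, one_mul, map_smul] at h
  have hcc : c * c = -1 := by
    obtain ⟨w, hw⟩ := exists_ne (0 : W)
    refine smul_left_injective ℂ hw ?_
    have h := LinearMap.congr_fun (hsq (4 * m) (by omega)) w
    have h' := LinearMap.congr_fun hp w
    simp only [Module.End.mul_apply, Module.End.one_apply] at h h'
    simpa [hlast, h', smul_smul] using h
  have hconj : starRingEnd ℂ c = -c := by
    rcases mul_self_eq_mul_self_iff.mp (hcc.trans Complex.I_mul_I.symm) with rfl | rfl <;> simp
  have hall : ∀ i < 4 * m + 1, ∀ x, A (g i x) = -g i (A x) := fun i hi x => by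
    rcases Nat.lt_succ_iff_lt_or_eq.mp hi with h | rfl
    · exact hanti i h x
    · rw [hlast, hlast, map_smulₛₗ, map_orderedProd_apply _ hanti, hconj,
        Even.neg_one_pow ⟨2 * m, by ring⟩, one_smul, neg_smul]
  have hinj : Function.Injective A := by
    refine LinearMap.ker_eq_bot.mp ((hirr _ fun i hi x hx => ?_).resolve_right ?_)
    · rw [LinearMap.mem_ker] at hx ⊢
      rw [hall i hi, hx, map_zero, neg_zero]
    · exact fun h => hA (LinearMap.ker_eq_top.mp h)
  have hsurj : Function.Surjective (A.comp A : W →ₗ[ℂ] W) :=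
    LinearMap.injective_iff_surjective.mp (hinj.comp hinj)
  exact ⟨A, ⟨hinj, Function.Surjective.of_comp hsurj⟩, hall⟩

end AnticommutingOperators

section Euclidean

variable {n : ℕ} {Q : QuadraticForm ℝ (EuclideanSpace ℝ (Fin n))}

theorem CliffordAlgebra.ι_single_mul_self
    (hQ : ∀ v : EuclideanSpace ℝ (Fin n), Q v = -‖v‖ ^ 2) (i : Fin n) :
    ι Q (EuclideanSpace.single i 1) * ι Q (EuclideanSpace.single i 1) = -1 := by
  rw [ι_sq_scalar, hQ]
  simp

theorem CliffordAlgebra.ι_single_mul_swap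
    (hQ : ∀ v : EuclideanSpace ℝ (Fin n), Q v = -‖v‖ ^ 2) {i j : Fin n} (hij : i ≠ j) :
    ι Q (EuclideanSpace.single i 1) * ι Q (EuclideanSpace.single j 1) =
      -(ι Q (EuclideanSpace.single j 1) * ι Q (EuclideanSpace.single i 1)) := by
  rw [eq_neg_iff_add_eq_zero, ι_mul_ι_add_swap, QuadraticMap.polar, hQ, hQ, hQ,
    norm_add_sq_real]
  simp [EuclideanSpace.inner_single_left, hij]

theorem EuclideanSpace.eq_sum_smul_single (v : EuclideanSpace ℝ (Fin n)) :
    v = ∑ i, v i • EuclideanSpace.single i (1 : ℝ) := by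
  simpa using ((EuclideanSpace.basisFun (Fin n) ℝ).sum_repr v).symm

end Euclidean


/-- Let `n ≡ 1 mod 4` and let `W` be an irreducible complex Clifford module
(over the Clifford algebra `Cl_n` of `Q v = -‖v‖²` on `ℝⁿ`).  Then there exists a
bijection `ν : W → W` which is conjugate-linear (additive with `ν(cψ) = c̄·ν(ψ)` for all
`c ∈ ℂ`, `ψ ∈ W`) and anticommutes with Clifford multiplication by vectors:
`ν(v·ψ) = -v·ν(ψ)` for all `v ∈ ℝⁿ` and `ψ ∈ W`. -/
theorem stmt_6 (n : ℕ) (hn : n % 4 = 1)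
    (Q : QuadraticForm ℝ (EuclideanSpace ℝ (Fin n)))
    (hQ : ∀ v : EuclideanSpace ℝ (Fin n), Q v = -‖v‖ ^ 2)
    (W : Type) [AddCommGroup W] [Module ℝ W] [Module ℂ W] [IsScalarTower ℝ ℂ W]
    [FiniteDimensional ℂ W] [Nontrivial W]
    (γ : CliffordAlgebra Q →ₐ[ℝ] Module.End ℂ W)
    (hirr : ∀ U : Submodule ℂ W,
      (∀ (v : EuclideanSpace ℝ (Fin n)), ∀ ψ ∈ U, γ (CliffordAlgebra.ι Q v) ψ ∈ U) →
      U = ⊥ ∨ U = ⊤) :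
    ∃ ν : W → W, Function.Bijective ν ∧
      (∀ φ ψ : W, ν (φ + ψ) = ν φ + ν ψ) ∧
      (∀ (c : ℂ) (ψ : W), ν (c • ψ) = (starRingEnd ℂ c) • ν ψ) ∧
      (∀ (v : EuclideanSpace ℝ (Fin n)) (ψ : W),
        ν (γ (CliffordAlgebra.ι Q v) ψ) = -(γ (CliffordAlgebra.ι Q v) (ν ψ))) := by
  have hg_eq : ∃ g : ℕ → Module.End ℂ W, ∀ i : Fin n,
      g i = γ (CliffordAlgebra.ι Q (EuclideanSpace.single i 1)) :=
    ⟨fun i => if h : i < n then γ (CliffordAlgebra.ι Q (EuclideanSpace.single ⟨i, h⟩ 1)) else 0,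
      fun i => by simp⟩
  obtain ⟨g, hg⟩ := hg_eq
  have expand : ∀ v x, γ (CliffordAlgebra.ι Q v) x = ∑ i : Fin n, (v i : ℂ) • g i x := by
    intro v x
    conv_lhs => rw [EuclideanSpace.eq_sum_smul_single v]
    simp only [map_sum, map_smul, LinearMap.sum_apply, LinearMap.smul_apply, hg]
    exact Finset.sum_congr rfl fun i _ => (algebraMap_smul ℂ (v i) _).symm
  obtain ⟨A, hbij, hA⟩ := exists_conjLinear_bijective_anticomm (g := g) hn
    (fun i hi => by
      rw [hg ⟨i, hi⟩, ← map_mul, CliffordAlgebra.ι_single_mul_self hQ, map_neg, map_one])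
    (fun i hi j hj hij => by
      rw [hg ⟨i, hi⟩, hg ⟨j, hj⟩, ← map_mul γ, ← map_mul γ, ← map_neg,
        CliffordAlgebra.ι_single_mul_swap hQ (by simpa using hij)])
    (fun U hU => hirr U fun v x hx => by
      rw [expand]
      exact U.sum_mem fun i _ => U.smul_mem _ (hU i i.2 x hx))
  refine ⟨A, hbij, map_add A, map_smulₛₗ A, fun v x => ?_⟩
  rw [expand, expand, map_sum, ← Finset.sum_neg_distrib]
  refine Finset.sum_congr rfl fun i _ => ?_
  rw [map_smulₛₗ, hA i i.2, Complex.conj_ofReal, smul_neg]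
end

section
/- Let n ≡ 3 mod 4 and let W be an irreducible complex Clifford module. Then there exists no ℝ-linear bijection ν : W → W satisfying ν(v·ψ) = -v·ν(ψ) for all v ∈ ℝⁿ and ψ ∈ W. -/
/-- Moving `x` past a product of elements that anticommute with it. -/
theorem mul_list_prod_of_forall_anticommute {A : Type*} [Ring A] (x : A) (l : List A)
    (h : ∀ y ∈ l, x * y = -(y * x)) : x * l.prod = (-1) ^ l.length * (l.prod * x) := by
  induction l with
  | nil => simp
  | cons y t ih =>
    have hy := h y (by simp)
    have ht := ih fun z hz => h z (by simp [hz])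
    rw [List.prod_cons, List.length_cons, ← mul_assoc, hy, neg_mul, mul_assoc, ht, pow_succ]
    rcases neg_one_pow_eq_or A t.length with e | e <;> rw [e] <;> noncomm_ring

/-- Moving a factor past a product of pairwise anticommuting elements. -/
theorem mul_list_prod_of_mem_of_pairwise_anticommute {A : Type*} [Ring A] (l : List A)
    (h : l.Pairwise fun x y => x * y = -(y * x)) (x : A) (hx : x ∈ l) :
    x * l.prod = (-1) ^ (l.length + 1) * (l.prod * x) := by
  induction l with
  | nil => simp at hx
  | cons y t ih =>
    rw [List.pairwise_cons] at h
    rw [List.prod_cons, List.length_cons]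
    rcases List.mem_cons.1 hx with rfl | hx
    · rw [mul_assoc x t.prod x, mul_list_prod_of_forall_anticommute x t h.1, pow_succ, pow_succ]
      rcases neg_one_pow_eq_or A t.length with e | e <;> rw [e] <;> noncomm_ring
    · have hyx : x * y = -(y * x) := by rw [h.1 x hx, neg_neg]
      rw [← mul_assoc, hyx, neg_mul, mul_assoc, ih h.2 hx, pow_succ _ (t.length + 1)]
      rcases neg_one_pow_eq_or A (t.length + 1) with e | e <;> rw [e] <;> noncomm_ring

/-- The square of a product of pairwise anticommuting square roots of `-1`. -/
theorem list_prod_mul_self_of_pairwise_anticommute {A : Type*} [Ring A] (l : List A)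
    (h : l.Pairwise fun x y => x * y = -(y * x)) (hsq : ∀ x ∈ l, x * x = -1) :
    l.prod * l.prod = (-1) ^ (l.length * (l.length + 1) / 2) := by
  induction l with
  | nil => simp
  | cons y t ih =>
    rw [List.pairwise_cons] at h
    have hcomm := mul_list_prod_of_forall_anticommute y t h.1
    have hy := hsq y (by simp)
    have ht := ih h.2 fun z hz => hsq z (by simp [hz])
    have hexp : (t.length + 1) * (t.length + 1 + 1) / 2
        = t.length * (t.length + 1) / 2 + (t.length + 1) := by
      rw [← Nat.add_mul_div_right _ _ two_pos]
      congr 1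
      ring
    have hpyp : t.prod * y = (-1) ^ t.length * (y * t.prod) := by
      rw [hcomm]
      rcases neg_one_pow_eq_or A t.length with e | e <;> simp [e]
    calc (y :: t).prod * (y :: t).prod = y * (t.prod * y) * t.prod := by
          simp only [List.prod_cons, mul_assoc]
      _ = (-1) ^ t.length * (y * y * (t.prod * t.prod)) := by
          rw [hpyp]
          rcases neg_one_pow_eq_or A t.length with e | e <;> rw [e] <;> noncomm_ring
      _ = _ := by
          rw [hy, ht, List.length_cons, hexp, pow_add, pow_succ]
          rcases neg_one_pow_eq_or A t.length with e | e <;> rw [e] <;> noncomm_ring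

namespace CliffordAlgebra

/-- A real-linear map that anticommutes with Clifford multiplication by vectors intertwines
the action of `x` with that of `involute x`. -/
theorem apply_eq_involute_apply_of_anticommute {V : Type*} [AddCommGroup V] [Module ℝ V]
    {Q : QuadraticForm ℝ V} {W : Type*} [AddCommGroup W] [Module ℝ W] [Module ℂ W]
    [IsScalarTower ℝ ℂ W] (γ : CliffordAlgebra Q →ₐ[ℝ] Module.End ℂ W) (ν : W →ₗ[ℝ] W)
    (h : ∀ v ψ, ν (γ (ι Q v) ψ) = -γ (ι Q v) (ν ψ)) (x : CliffordAlgebra Q) (ψ : W) :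
    ν (γ x ψ) = γ (involute x) (ν ψ) := by
  induction x using CliffordAlgebra.induction generalizing ψ with
  | algebraMap r => simp [Algebra.algebraMap_eq_smul_one]
  | ι v => simp [h]
  | mul a b ha hb => simp [ha, hb]
  | add a b ha hb => simp [ha, hb]

section VolumeElement

variable {n : ℕ} (Q : QuadraticForm ℝ (EuclideanSpace ℝ (Fin n)))

/-- The volume element `ι(e₁)⋯ι(eₙ)`. -/
noncomputable def volumeElement : CliffordAlgebra Q :=
  ((List.ofFn fun i => EuclideanSpace.single i (1 : ℝ)).map (ι Q)).prod

theorem involute_volumeElement : involute (volumeElement Q) = (-1 : ℝ) ^ n • volumeElement Q := by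
  rw [volumeElement, involute_prod_map_ι, List.length_ofFn]

variable {Q}

theorem pairwise_anticommute_ι_single (hQ : ∀ v, Q v = -‖v‖ ^ 2) :
    ((List.ofFn fun i => EuclideanSpace.single i (1 : ℝ)).map (ι Q)).Pairwise
      fun x y => x * y = -(y * x) := by
  rw [List.map_ofFn, List.pairwise_ofFn]
  intro i j hij
  refine ι_mul_ι_comm_of_isOrtho ?_
  rw [QuadraticMap.isOrtho_def, hQ, hQ, hQ]
  have := norm_add_sq_eq_norm_sq_add_norm_sq_real (x := EuclideanSpace.single i (1 : ℝ))
    (y := EuclideanSpace.single j 1) (by simp [EuclideanSpace.inner_single_left, hij.ne])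
  linarith [sq ‖EuclideanSpace.single i (1 : ℝ) + EuclideanSpace.single j (1 : ℝ)‖,
    sq ‖EuclideanSpace.single i (1 : ℝ)‖, sq ‖EuclideanSpace.single j (1 : ℝ)‖]

theorem volumeElement_mul_self (hQ : ∀ v, Q v = -‖v‖ ^ 2) :
    volumeElement Q * volumeElement Q = (-1) ^ (n * (n + 1) / 2) := by
  have := list_prod_mul_self_of_pairwise_anticommute _ (pairwise_anticommute_ι_single hQ) (by
    simp [List.mem_ofFn, ι_sq_scalar, hQ])
  simpa [volumeElement] using this

theorem commute_ι_volumeElement (hQ : ∀ v, Q v = -‖v‖ ^ 2) (hn : Odd n)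
    (v : EuclideanSpace ℝ (Fin n)) : Commute (ι Q v) (volumeElement Q) := by
  have key : LinearMap.mulRight ℝ (volumeElement Q) ∘ₗ ι Q
      = LinearMap.mulLeft ℝ (volumeElement Q) ∘ₗ ι Q := by
    refine (EuclideanSpace.basisFun (Fin n) ℝ).toBasis.ext fun i => ?_
    have := mul_list_prod_of_mem_of_pairwise_anticommute _ (pairwise_anticommute_ι_single hQ)
      (ι Q (EuclideanSpace.single i 1)) (List.mem_map_of_mem (List.mem_ofFn.2 ⟨i, rfl⟩))
    simpa [volumeElement, hn.add_one.neg_one_pow] using this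
  exact LinearMap.congr_fun key v

end VolumeElement

end CliffordAlgebra

/-- Let `n ≡ 3 mod 4` and let `W` be an irreducible complex Clifford module
(over the Clifford algebra `Cl_n` of `Q v = -‖v‖²` on `ℝⁿ`).  Then there exists no
ℝ-linear bijection `ν : W → W` satisfying `ν(v·ψ) = -v·ν(ψ)` for all `v ∈ ℝⁿ`, `ψ ∈ W`. -/
theorem stmt_7 (n : ℕ) (hn : n % 4 = 3)
    (Q : QuadraticForm ℝ (EuclideanSpace ℝ (Fin n)))
    (hQ : ∀ v : EuclideanSpace ℝ (Fin n), Q v = -‖v‖ ^ 2)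
    (W : Type) [AddCommGroup W] [Module ℝ W] [Module ℂ W] [IsScalarTower ℝ ℂ W]
    [FiniteDimensional ℂ W] [Nontrivial W]
    (γ : CliffordAlgebra Q →ₐ[ℝ] Module.End ℂ W)
    (hirr : ∀ U : Submodule ℂ W,
      (∀ (v : EuclideanSpace ℝ (Fin n)), ∀ ψ ∈ U, γ (CliffordAlgebra.ι Q v) ψ ∈ U) →
      U = ⊥ ∨ U = ⊤) :
    ¬ ∃ ν : W →ₗ[ℝ] W, Function.Bijective ν ∧
      ∀ (v : EuclideanSpace ℝ (Fin n)) (ψ : W),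
        ν (γ (CliffordAlgebra.ι Q v) ψ) = -(γ (CliffordAlgebra.ι Q v) (ν ψ)) := by
  rintro ⟨ν, hν, hanti⟩
  have hodd : Odd n := Nat.odd_iff.2 (by omega)
  have heven : Even (n * (n + 1) / 2) := by
    obtain ⟨k, rfl⟩ : ∃ k, n = 4 * k + 3 := ⟨n / 4, by omega⟩
    refine ⟨(4 * k + 3) * (k + 1), Nat.div_eq_of_eq_mul_left two_pos ?_⟩
    ring
  set E := γ (CliffordAlgebra.volumeElement Q) with hE
  have hE2 : E * E = 1 := by
    rw [hE, ← map_mul, CliffordAlgebra.volumeElement_mul_self hQ, heven.neg_one_pow, map_one]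
  have hνE (ψ : W) : ν (E ψ) = -E (ν ψ) := by
    rw [hE, CliffordAlgebra.apply_eq_involute_apply_of_anticommute γ ν hanti,
      CliffordAlgebra.involute_volumeElement, hodd.neg_one_pow]
    simp
  have hcomm (v : EuclideanSpace ℝ (Fin n)) (ψ : W) :
      E (γ (CliffordAlgebra.ι Q v) ψ) = γ (CliffordAlgebra.ι Q v) (E ψ) :=
    LinearMap.congr_fun ((CliffordAlgebra.commute_ι_volumeElement hQ hodd v).map γ).eq.symm ψ
  obtain ⟨ψ, hψ⟩ := exists_ne (0 : W)
  have hνψ : ν ψ ≠ 0 := fun h => hψ (hν.injective (by rw [h, map_zero]))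
  -- The `1`-eigenspace of the volume element is a submodule, hence trivial or everything.
  have hE_eq : (∀ φ, E φ = -φ) ∨ ∀ φ, E φ = φ := by
    refine (hirr (LinearMap.ker (E - 1)) fun v φ hφ => ?_).imp (fun h φ => ?_) fun h φ => ?_
    · rw [LinearMap.mem_ker, LinearMap.sub_apply, Module.End.one_apply, sub_eq_zero] at hφ ⊢
      rw [hcomm, hφ]
    · have : E φ + φ ∈ LinearMap.ker (E - 1) := by
        have hEE : E (E φ) = φ := LinearMap.congr_fun hE2 φ
        simp [hEE, add_comm]
      rw [h, Submodule.mem_bot] at this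
      exact eq_neg_of_add_eq_zero_left this
    · have : φ ∈ LinearMap.ker (E - 1) := h ▸ Submodule.mem_top
      simpa [sub_eq_zero] using this
  have h2 : ν ψ = -ν ψ := by
    have := hνE ψ
    rcases hE_eq with h | h <;> simpa [h, neg_eq_iff_eq_neg] using this
  have h2smul : (2 : ℝ) • ν ψ = 0 := by rw [two_smul, ← eq_neg_iff_add_eq_zero, ← h2]
  exact hνψ ((smul_eq_zero_iff_right two_ne_zero).1 h2smul)
end

section
/- Let n ≥ 2, let W be a complex Clifford module equipped with a compatible Hermitian inner product, and let ω_{n-1} := 2π^{n/2}/Γ(n/2). Then the kernel G_eucl(x,y)ψ₀ := -(1/ω_{n-1}) ‖x-y‖^{-n} ((x-y)·ψ₀) is a fundamental solution of the Euclidean Dirac operator: for every ψ₀ ∈ W, every y ∈ ℝⁿ and every compactly supported smooth φ : ℝⁿ → W, the function x ↦ ⟨G_eucl(x,y)ψ₀, Dφ(x)⟩ is integrable on ℝⁿ and ∫_{ℝⁿ} ⟨G_eucl(x,y)ψ₀, Dφ(x)⟩ dx = ⟨ψ₀, φ(y)⟩. -/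
open scoped InnerProductSpace

section

open MeasureTheory Filter Topology Module Set

theorem hasDerivAt_pow_mul_one_add_sq_rpow {n : ℕ} (hn : n ≠ 0) (r : ℝ) :
    HasDerivAt (fun r : ℝ => r ^ n * (1 + r ^ 2) ^ (-(n / 2 : ℝ)))
      (r ^ (n - 1) * (n * (1 + r ^ 2) ^ (-(n / 2 : ℝ) - 1))) r := by
  have hpos : 0 < 1 + r ^ 2 := by positivity
  have h := (hasDerivAt_pow n r).mul
    (((hasDerivAt_pow 2 r).const_add 1).rpow_const (p := -(n / 2 : ℝ)) (Or.inl hpos.ne'))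
  refine h.congr_deriv ?_
  have h1 : (1 + r ^ 2) ^ (-(n / 2 : ℝ)) = (1 + r ^ 2) ^ (-(n / 2 : ℝ) - 1) * (1 + r ^ 2) := by
    rw [← Real.rpow_add_one hpos.ne']; simp
  obtain ⟨m, rfl⟩ := Nat.exists_eq_succ_of_ne_zero hn
  rw [h1]
  simp only [Nat.succ_eq_add_one, Nat.add_sub_cancel]
  push_cast
  ring

theorem pow_mul_one_add_sq_rpow_eq (n : ℕ) {r : ℝ} (hr : 0 < r) :
    r ^ n * (1 + r ^ 2) ^ (-(n / 2 : ℝ)) = (r⁻¹ ^ 2 + 1) ^ (-(n / 2 : ℝ)) := by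
  have h1 : r ^ n = (r ^ 2) ^ (n / 2 : ℝ) := by
    rw [← Real.rpow_natCast r 2, ← Real.rpow_mul hr.le, ← Real.rpow_natCast]
    congr 1; push_cast; ring
  have h2 : 1 + r ^ 2 = r ^ 2 * (r⁻¹ ^ 2 + 1) := by field_simp
  rw [h2, Real.mul_rpow (by positivity) (by positivity), ← mul_assoc, h1,
    ← Real.rpow_add (by positivity)]
  simp

theorem tendsto_pow_mul_one_add_sq_rpow (n : ℕ) :
    Tendsto (fun r : ℝ => r ^ n * (1 + r ^ 2) ^ (-(n / 2 : ℝ))) atTop (𝓝 1) := by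
  have h : Tendsto (fun r : ℝ => (r⁻¹ ^ 2 + 1) ^ (-(n / 2 : ℝ))) atTop (𝓝 1) := by
    have h1 : Tendsto (fun r : ℝ => r⁻¹ ^ 2 + 1) atTop (𝓝 1) := by
      simpa using (tendsto_inv_atTop_zero.pow 2).add_const (1 : ℝ)
    simpa using h1.rpow_const (p := -(n / 2 : ℝ)) (Or.inl one_ne_zero)
  exact h.congr' <| (eventually_gt_atTop 0).mono fun r hr =>
    (pow_mul_one_add_sq_rpow_eq n hr).symm

theorem integral_Ioi_pow_mul_one_add_sq_rpow {n : ℕ} (hn : n ≠ 0) :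
    ∫ r in Ioi (0 : ℝ), r ^ (n - 1) * (n * (1 + r ^ 2) ^ (-(n / 2 : ℝ) - 1)) = 1 := by
  have hint := integrableOn_Ioi_deriv_of_nonneg'
    (fun r _ => hasDerivAt_pow_mul_one_add_sq_rpow hn r)
    (fun r (hr : 0 < r) => by positivity) (tendsto_pow_mul_one_add_sq_rpow n)
  rw [integral_Ioi_of_hasDerivAt_of_tendsto'
    (fun r _ => hasDerivAt_pow_mul_one_add_sq_rpow hn r) hint (tendsto_pow_mul_one_add_sq_rpow n)]
  simp [hn]

theorem natCast_mul_volume_unitBall {n : ℕ} (hn : n ≠ 0) :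
    n * volume.real (Metric.ball (0 : EuclideanSpace ℝ (Fin n)) 1) =
      2 * Real.pi ^ ((n : ℝ) / 2) / Real.Gamma ((n : ℝ) / 2) := by
  have : Nonempty (Fin n) := Fin.pos_iff_nonempty.mp (Nat.pos_of_ne_zero hn)
  have hpos : (0 : ℝ) < n / 2 := by positivity
  have hG := Real.Gamma_pos_of_pos hpos
  have h : √Real.pi ^ n = Real.pi ^ ((n : ℝ) / 2) := by
    rw [Real.sqrt_eq_rpow, ← Real.rpow_natCast, ← Real.rpow_mul Real.pi_pos.le]
    congr 1; ring
  rw [measureReal_def, EuclideanSpace.volume_ball]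
  simp only [Fintype.card_fin, ENNReal.ofReal_one, one_pow, one_mul]
  rw [ENNReal.toReal_ofReal (by positivity), h, Real.Gamma_add_one hpos.ne']
  field_simp

theorem integral_one_add_norm_sq_rpow {n : ℕ} (hn : n ≠ 0) :
    ∫ x : EuclideanSpace ℝ (Fin n), n * (1 + ‖x‖ ^ 2) ^ (-(n / 2 : ℝ) - 1) =
      2 * Real.pi ^ ((n : ℝ) / 2) / Real.Gamma ((n : ℝ) / 2) := by
  have : Nonempty (Fin n) := Fin.pos_iff_nonempty.mp (Nat.pos_of_ne_zero hn)
  rw [integral_fun_norm_addHaar volume (fun r : ℝ => n * (1 + r ^ 2) ^ (-(n / 2 : ℝ) - 1))]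
  simp only [finrank_euclideanSpace_fin, smul_eq_mul, nsmul_eq_mul,
    integral_Ioi_pow_mul_one_add_sq_rpow hn, mul_one]
  exact natCast_mul_volume_unitBall hn

theorem tendsto_integral_one_add_sq_rpow_smul {n : ℕ} (hn : n ≠ 0)
    {g : EuclideanSpace ℝ (Fin n) → ℂ} (hg : Continuous g) (hgs : HasCompactSupport g)
    {ω : ℝ} (hω : ω = 2 * Real.pi ^ ((n : ℝ) / 2) / Real.Gamma ((n : ℝ) / 2)) :
    Tendsto (fun c : ℝ => ∫ x, (c ^ n * (ω⁻¹ * (n * (1 + ‖c • x‖ ^ 2) ^ (-(n / 2 : ℝ) - 1)))) • g x)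
      atTop (𝓝 (g 0)) := by
  have hωpos : 0 < ω := by
    have := Real.Gamma_pos_of_pos (show (0 : ℝ) < n / 2 by positivity)
    rw [hω]; positivity
  have key := tendsto_integral_comp_smul_smul_of_integrable (μ := volume)
    (φ := fun x : EuclideanSpace ℝ (Fin n) => ω⁻¹ * (n * (1 + ‖x‖ ^ 2) ^ (-(n / 2 : ℝ) - 1)))
    (fun x => by positivity)
    (by rw [integral_const_mul, integral_one_add_norm_sq_rpow hn, ← hω, inv_mul_cancel₀ hωpos.ne'])
    ?_ (hg.integrable_of_hasCompactSupport hgs) hg.continuousAt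
  · simpa only [finrank_euclideanSpace_fin] using key
  have h1 : Tendsto (fun r : ℝ => r ^ n * (1 + r ^ 2) ^ (-(n / 2 : ℝ)) * (1 + r ^ 2)⁻¹) atTop
      (𝓝 (1 * 0)) := (tendsto_pow_mul_one_add_sq_rpow n).mul
    (tendsto_inv_atTop_zero.comp (tendsto_atTop_add_const_left _ 1 (tendsto_pow_atTop two_ne_zero)))
  have h2 := (h1.const_mul (ω⁻¹ * n)).comp
    (tendsto_norm_cobounded_atTop (E := EuclideanSpace ℝ (Fin n)))
  rw [mul_zero, mul_zero] at h2
  refine h2.congr fun x => ?_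
  simp only [Function.comp, finrank_euclideanSpace_fin]
  rw [Real.rpow_sub_one (by positivity)]
  ring

variable {n : ℕ} {W : Type*} [NormedAddCommGroup W] [InnerProductSpace ℂ W]

/-- The Dirac operator of a Clifford multiplication `c`. -/
noncomputable def diracOp (c : EuclideanSpace ℝ (Fin n) →L[ℝ] W →L[ℝ] W)
    (φ : EuclideanSpace ℝ (Fin n) → W) (x : EuclideanSpace ℝ (Fin n)) : W :=
  ∑ i, c (EuclideanSpace.single i 1) (fderiv ℝ φ x (EuclideanSpace.single i 1))

theorem continuous_diracOp (c : EuclideanSpace ℝ (Fin n) →L[ℝ] W →L[ℝ] W)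
    {φ : EuclideanSpace ℝ (Fin n) → W} (hφ : ContDiff ℝ 1 φ) : Continuous (diracOp c φ) := by
  have := hφ.continuous_fderiv one_ne_zero
  unfold diracOp
  fun_prop

theorem hasCompactSupport_diracOp (c : EuclideanSpace ℝ (Fin n) →L[ℝ] W →L[ℝ] W)
    {φ : EuclideanSpace ℝ (Fin n) → W} (hφ : HasCompactSupport φ) :
    HasCompactSupport (diracOp c φ) :=
  (hφ.fderiv (𝕜 := ℝ)).mono' <| by
    refine (Function.support_subset_iff'.mpr fun x hx => ?_)
    simp [diracOp, image_eq_zero_of_notMem_tsupport hx]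

theorem diracOp_comp_add_right (c : EuclideanSpace ℝ (Fin n) →L[ℝ] W →L[ℝ] W)
    (φ : EuclideanSpace ℝ (Fin n) → W) (y x : EuclideanSpace ℝ (Fin n)) :
    diracOp c (fun u => φ (u + y)) x = diracOp c φ (x + y) := by
  simp [diracOp, fderiv_comp_add_right]

/-- The Dirac operator is formally self-adjoint. -/
theorem integral_inner_diracOp_right {c : EuclideanSpace ℝ (Fin n) →L[ℝ] W →L[ℝ] W}
    (hc : ∀ v φ ψ, ⟪c v φ, ψ⟫_ℂ = -⟪φ, c v ψ⟫_ℂ)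
    {F φ : EuclideanSpace ℝ (Fin n) → W} (hF : ContDiff ℝ 1 F) (hφ : ContDiff ℝ 1 φ)
    (hφs : HasCompactSupport φ) :
    ∫ x, ⟪F x, diracOp c φ x⟫_ℂ = ∫ x, ⟪diracOp c F x, φ x⟫_ℂ := by
  have hF' := hF.continuous_fderiv one_ne_zero
  have hφ' := hφ.continuous_fderiv one_ne_zero
  have hFc := hF.continuous
  have hφc := hφ.continuous
  have hφs' := hφs.fderiv (𝕜 := ℝ)
  have h0 (i : Fin n) : Integrable fun x =>
      ⟪F x, c (EuclideanSpace.single i 1) (fderiv ℝ φ x (EuclideanSpace.single i 1))⟫_ℂ := by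
    refine Continuous.integrable_of_hasCompactSupport (by fun_prop) (hφs'.mono fun x hx h => hx ?_)
    simp [h]
  have h1 (i : Fin n) : Integrable fun x =>
      ⟪fderiv ℝ F x (EuclideanSpace.single i 1), c (EuclideanSpace.single i 1) (φ x)⟫_ℂ := by
    refine Continuous.integrable_of_hasCompactSupport (by fun_prop) (hφs.mono fun x hx h => hx ?_)
    simp [h]
  have h2 (i : Fin n) : Integrable fun x => ⟪F x, c (EuclideanSpace.single i 1) (φ x)⟫_ℂ := by
    refine Continuous.integrable_of_hasCompactSupport (by fun_prop) (hφs.mono fun x hx h => hx ?_)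
    simp [h]
  simp only [diracOp, inner_sum, sum_inner, hc]
  rw [integral_finsetSum _ fun i _ => h0 i,
    integral_finsetSum _ fun i _ => by simpa using (h1 i).neg]
  refine Finset.sum_congr rfl fun i _ => ?_
  rw [integral_neg]
  exact integral_bilinear_hasFDerivAt_right_eq_neg_left_of_integrable
    (B := (isBoundedBilinearMap_inner (𝕜 := ℂ) (E := W)).toContinuousLinearMap)
    (g := fun x => c (EuclideanSpace.single i 1) (φ x))
    (g' := fun x => (c (EuclideanSpace.single i 1)).comp (fderiv ℝ φ x))
    (h1 i) (h0 i) (h2 i)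
    (fun x _ => (hF.differentiable one_ne_zero x).hasFDerivAt)
    (fun x _ => (c _).hasFDerivAt.comp x (hφ.differentiable one_ne_zero x).hasFDerivAt)

theorem diracOp_one_add_norm_sq_rpow_smul {c : EuclideanSpace ℝ (Fin n) →L[ℝ] W →L[ℝ] W}
    (hc : ∀ v ψ, c v (c v ψ) = -‖v‖ ^ 2 • ψ) (t : ℝ) (ψ : W) (x : EuclideanSpace ℝ (Fin n)) :
    diracOp c (fun u => (1 + ‖t • u‖ ^ 2) ^ (-(n / 2 : ℝ)) • c u ψ) x =
      -(n * (1 + ‖t • x‖ ^ 2) ^ (-(n / 2 : ℝ) - 1)) • ψ := by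
  have hpos : 0 < 1 + ‖t • x‖ ^ 2 := by positivity
  have hh : HasFDerivAt (fun u : EuclideanSpace ℝ (Fin n) => (1 + ‖t • u‖ ^ 2) ^ (-(n / 2 : ℝ)))
      ((-(n * t ^ 2 * (1 + ‖t • x‖ ^ 2) ^ (-(n / 2 : ℝ) - 1))) • innerSL ℝ x) x := by
    refine (((((hasFDerivAt_id x).const_smul t).norm_sq).const_add 1).rpow_const
      (p := -(n / 2 : ℝ)) (Or.inl hpos.ne')).congr_fderiv ?_
    ext v
    simp
    ring
  have hF : fderiv ℝ (fun u => (1 + ‖t • u‖ ^ 2) ^ (-(n / 2 : ℝ)) • c u ψ) x = _ :=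
    (hh.smul (c.flip ψ).hasFDerivAt).fderiv
  have hsum : ∑ i, x i • c (EuclideanSpace.single i 1) (c x ψ) = -‖x‖ ^ 2 • ψ := by
    have h := congrArg (fun v => c v (c x ψ)) ((EuclideanSpace.basisFun (Fin n) ℝ).sum_repr x)
    simpa [hc] using h
  have hone (i : Fin n) : c (EuclideanSpace.single i 1) (c (EuclideanSpace.single i 1) ψ) = -ψ := by
    simp [hc]
  have hs : (1 + ‖t • x‖ ^ 2) ^ (-(n / 2 : ℝ)) =
      (1 + ‖t • x‖ ^ 2) ^ (-(n / 2 : ℝ) - 1) * (1 + ‖t • x‖ ^ 2) := by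
    rw [← Real.rpow_add_one hpos.ne']; simp
  have hnt : ‖t • x‖ ^ 2 = t ^ 2 * ‖x‖ ^ 2 := by rw [norm_smul, mul_pow, Real.norm_eq_abs, sq_abs]
  simp only [diracOp, hF]
  simp only [add_apply, smul_apply,
    ContinuousLinearMap.smulRight_apply, ContinuousLinearMap.flip_apply, innerSL_apply_apply,
    map_add, map_smul, hone, Finset.sum_add_distrib, EuclideanSpace.inner_single_right,
    smul_eq_mul, mul_smul, ← Finset.smul_sum]
  simp only [RCLike.conj_to_real, one_smul, hsum]
  simp only [Finset.sum_const, Finset.card_univ, Fintype.card_fin, ← Nat.cast_smul_eq_nsmul ℝ,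
    smul_neg, ← neg_smul, smul_smul, ← add_smul]
  congr 1
  rw [hs, hnt]
  ring

theorem integrable_inner_norm_pow_smul_diracOp
    {c : EuclideanSpace ℝ (Fin n) →L[ℝ] W →L[ℝ] W} (hn : n ≠ 0) (ψ : W) {φ : EuclideanSpace ℝ (Fin n) → W} (hφ : ContDiff ℝ 1 φ)
    (hφs : HasCompactSupport φ) :
    Integrable fun x => ⟪(‖x‖ ^ n)⁻¹ • c x ψ, diracOp c φ x⟫_ℂ := by
  have hD := continuous_diracOp c hφ
  have hloc : LocallyIntegrable (fun x : EuclideanSpace ℝ (Fin n) => (‖x‖ ^ n)⁻¹ * ‖x‖) := by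
    refine locallyIntegrable_of_norm_le_rpow (C := 1) (α := n - 1) ?_ ?_
      (.of_forall fun x => ?_) (by fun_prop)
    · simpa using Nat.one_le_iff_ne_zero.mpr hn
    · simp
    rcases (norm_nonneg x).eq_or_lt with h | h
    · simp [← h]
      positivity
    · rw [Real.norm_of_nonneg (by positivity), one_mul, neg_sub, sub_eq_neg_add,
        Real.rpow_add_one h.ne', Real.rpow_neg h.le, Real.rpow_natCast]
  have hint := (hloc.integrable_smul_right_of_hasCompactSupport hD.norm
    (hasCompactSupport_diracOp c hφs).norm).const_mul ‖c.flip ψ‖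
  refine hint.mono' ?_ (.of_forall fun x => ?_)
  · exact AEStronglyMeasurable.inner
      (Measurable.aestronglyMeasurable (f := fun x : EuclideanSpace ℝ (Fin n) => (‖x‖ ^ n)⁻¹)
        (by fun_prop) |>.smul (by fun_prop)) hD.aestronglyMeasurable
  refine (norm_inner_le_norm _ _).trans ?_
  have := (c.flip ψ).le_opNorm x
  rw [ContinuousLinearMap.flip_apply] at this
  rw [norm_smul, Real.norm_of_nonneg (by positivity), smul_eq_mul]
  calc (‖x‖ ^ n)⁻¹ * ‖c x ψ‖ * ‖diracOp c φ x‖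
      ≤ (‖x‖ ^ n)⁻¹ * (‖c.flip ψ‖ * ‖x‖) * ‖diracOp c φ x‖ := by gcongr
    _ = _ := by ring

theorem pow_mul_one_add_norm_smul_sq_rpow_eq {t : ℝ} (ht : 0 < t)
    {x : EuclideanSpace ℝ (Fin n)} (hx : x ≠ 0) :
    t ^ n * (1 + ‖t • x‖ ^ 2) ^ (-(n / 2 : ℝ)) =
      (‖x‖ ^ n)⁻¹ * ((t * ‖x‖) ^ n * (1 + (t * ‖x‖) ^ 2) ^ (-(n / 2 : ℝ))) := by
  have := pow_ne_zero n (norm_ne_zero_iff.mpr hx)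
  rw [norm_smul, Real.norm_of_nonneg ht.le, mul_pow t ‖x‖ n, mul_comm (t ^ n) (‖x‖ ^ n), mul_assoc,
    inv_mul_cancel_left₀ this]

theorem integral_inner_norm_pow_smul_diracOp {c : EuclideanSpace ℝ (Fin n) →L[ℝ] W →L[ℝ] W}
    (hn : n ≠ 0) (hskew : ∀ v φ ψ, ⟪c v φ, ψ⟫_ℂ = -⟪φ, c v ψ⟫_ℂ)
    (hsq : ∀ v ψ, c v (c v ψ) = -‖v‖ ^ 2 • ψ)
    {ω : ℝ} (hω : ω = 2 * Real.pi ^ ((n : ℝ) / 2) / Real.Gamma ((n : ℝ) / 2))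
    (ψ : W) {φ : EuclideanSpace ℝ (Fin n) → W} (hφ : ContDiff ℝ 1 φ)
    (hφs : HasCompactSupport φ) :
    ∫ x, ⟪-(ω⁻¹ * (‖x‖ ^ n)⁻¹) • c x ψ, diracOp c φ x⟫_ℂ = ⟪ψ, φ 0⟫_ℂ := by
  have : Nonempty (Fin n) := Fin.pos_iff_nonempty.mp (Nat.pos_of_ne_zero hn)
  have hD := continuous_diracOp c hφ
  have hI := integrable_inner_norm_pow_smul_diracOp (c := c) hn ψ hφ hφs
  have hreg (t : ℝ) : ContDiff ℝ 1 fun u : EuclideanSpace ℝ (Fin n) =>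
      (1 + ‖t • u‖ ^ 2) ^ (-(n / 2 : ℝ)) • c u ψ :=
    ((contDiff_const.add ((contDiff_id.const_smul t).norm_sq ℝ)).rpow_const_of_ne
      fun u => by positivity).smul (c.flip ψ).contDiff
  have hlim₁ := tendsto_integral_one_add_sq_rpow_smul hn (g := fun x => ⟪ψ, φ x⟫_ℂ)
    (by have := hφ.continuous; fun_prop) (hφs.mono fun x hx h => hx (by simp [h])) hω
  have hlim₂ : Tendsto (fun t : ℝ => ∫ x,
      ⟪(t ^ n * (1 + ‖t • x‖ ^ 2) ^ (-(n / 2 : ℝ))) • c x ψ, diracOp c φ x⟫_ℂ) atTop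
      (𝓝 (∫ x, ⟪(‖x‖ ^ n)⁻¹ • c x ψ, diracOp c φ x⟫_ℂ)) := by
    have hne : ∀ᵐ x : EuclideanSpace ℝ (Fin n), x ≠ 0 := Measure.ae_ne volume 0
    refine tendsto_integral_filter_of_dominated_convergence _ ?_ ?_ hI.norm ?_
    · refine .of_forall fun t => Continuous.aestronglyMeasurable ?_
      simp only [mul_smul]
      exact ((hreg t).continuous.const_smul (t ^ n)).inner hD
    · filter_upwards [eventually_gt_atTop 0] with t ht
      filter_upwards [hne] with x hx
      have hpos := mul_pos ht (norm_pos_iff.mpr hx)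
      rw [pow_mul_one_add_norm_smul_sq_rpow_eq ht hx, mul_comm, mul_smul, inner_smul_left_eq_smul,
        norm_smul, Real.norm_of_nonneg (by positivity), pow_mul_one_add_sq_rpow_eq n hpos]
      refine mul_le_of_le_one_left (norm_nonneg _) (Real.rpow_le_one_of_one_le_of_nonpos ?_ ?_)
      · exact le_add_of_nonneg_left (by positivity)
      · exact neg_nonpos.mpr (by positivity)
    · filter_upwards [hne] with x hx
      refine Tendsto.inner (Tendsto.smul_const ?_ _) tendsto_const_nhds
      have h := ((tendsto_pow_mul_one_add_sq_rpow n).comp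
        (tendsto_id.atTop_mul_const (norm_pos_iff.mpr hx))).const_mul (‖x‖ ^ n)⁻¹
      rw [mul_one] at h
      refine h.congr' ?_
      filter_upwards [eventually_gt_atTop 0] with t ht
      exact (pow_mul_one_add_norm_smul_sq_rpow_eq ht hx).symm
  have hreg_eq (t : ℝ) :
      -ω⁻¹ • ∫ x, ⟪(t ^ n * (1 + ‖t • x‖ ^ 2) ^ (-(n / 2 : ℝ))) • c x ψ, diracOp c φ x⟫_ℂ =
        ∫ x, (t ^ n * (ω⁻¹ * (n * (1 + ‖t • x‖ ^ 2) ^ (-(n / 2 : ℝ) - 1)))) • ⟪ψ, φ x⟫_ℂ := by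
    have h := integral_inner_diracOp_right hskew (hreg t) hφ hφs
    simp only [diracOp_one_add_norm_sq_rpow_smul hsq] at h
    simp only [mul_smul (t ^ n), inner_smul_left_eq_smul _ _ (t ^ n)]
    rw [integral_smul, h, smul_smul, ← integral_smul]
    refine integral_congr_ae (.of_forall fun x => ?_)
    simp only [inner_smul_left_eq_smul, smul_smul]
    congr 1
    ring
  have hsmul (x : EuclideanSpace ℝ (Fin n)) :
      ⟪-(ω⁻¹ * (‖x‖ ^ n)⁻¹) • c x ψ, diracOp c φ x⟫_ℂ =
        -ω⁻¹ • ⟪(‖x‖ ^ n)⁻¹ • c x ψ, diracOp c φ x⟫_ℂ := by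
    rw [← neg_mul, mul_smul, inner_smul_left_eq_smul]
  simp only [hsmul, integral_smul]
  exact tendsto_nhds_unique ((hlim₂.const_smul (-ω⁻¹)).congr hreg_eq) hlim₁

end

open MeasureTheory in
/-- Let `n ≥ 2`, let `W` be a complex Clifford module (over the Clifford
algebra `Cl_n` of `Q v = -‖v‖²` on `ℝⁿ`) with a compatible Hermitian inner product
(`⟨v·φ,ψ⟩ = -⟨φ,v·ψ⟩`), and let `ω_{n-1} = 2π^{n/2}/Γ(n/2)`.  Then the kernel
`G(x,y)ψ₀ = -(1/ω_{n-1}) ‖x-y‖⁻ⁿ ((x-y)·ψ₀)` is a fundamental solution of the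
Euclidean Dirac operator: for all `ψ₀ ∈ W`, `y ∈ ℝⁿ` and compactly supported smooth
`φ : ℝⁿ → W`, the function `x ↦ ⟨G(x,y)ψ₀, Dφ(x)⟩` is integrable and
`∫ ⟨G(x,y)ψ₀, Dφ(x)⟩ dx = ⟨ψ₀, φ(y)⟩`. -/
theorem stmt_9 (n : ℕ) (hn : 2 ≤ n)
    (Q : QuadraticForm ℝ (EuclideanSpace ℝ (Fin n)))
    (hQ : ∀ v : EuclideanSpace ℝ (Fin n), Q v = -‖v‖ ^ 2)
    (W : Type) [NormedAddCommGroup W] [InnerProductSpace ℂ W]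
    [FiniteDimensional ℂ W] [Nontrivial W]
    (γ : CliffordAlgebra Q →ₐ[ℝ] Module.End ℂ W)
    (hcompat : ∀ (v : EuclideanSpace ℝ (Fin n)) (φ ψ : W),
      ⟪γ (CliffordAlgebra.ι Q v) φ, ψ⟫_ℂ = -⟪φ, γ (CliffordAlgebra.ι Q v) ψ⟫_ℂ)
    (ωn : ℝ) (hωn : ωn = 2 * Real.pi ^ ((n : ℝ) / 2) / Real.Gamma ((n : ℝ) / 2))
    (G : EuclideanSpace ℝ (Fin n) → EuclideanSpace ℝ (Fin n) → W → W)
    (hG : ∀ (x y : EuclideanSpace ℝ (Fin n)) (ψ₀ : W),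
      G x y ψ₀ = -(ωn⁻¹ * (‖x - y‖ ^ n)⁻¹) • γ (CliffordAlgebra.ι Q (x - y)) ψ₀)
    (ψ₀ : W) (y : EuclideanSpace ℝ (Fin n))
    (φ : EuclideanSpace ℝ (Fin n) → W)
    (hφsmooth : ContDiff ℝ (⊤ : ℕ∞) φ) (hφsupp : HasCompactSupport φ) :
    MeasureTheory.Integrable (fun x : EuclideanSpace ℝ (Fin n) =>
      ⟪G x y ψ₀, ∑ i : Fin n, γ (CliffordAlgebra.ι Q (EuclideanSpace.single i (1 : ℝ)))
        (fderiv ℝ φ x (EuclideanSpace.single i (1 : ℝ)))⟫_ℂ) ∧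
    ∫ x : EuclideanSpace ℝ (Fin n),
      ⟪G x y ψ₀, ∑ i : Fin n, γ (CliffordAlgebra.ι Q (EuclideanSpace.single i (1 : ℝ)))
        (fderiv ℝ φ x (EuclideanSpace.single i (1 : ℝ)))⟫_ℂ = ⟪ψ₀, φ y⟫_ℂ := by
  
  obtain ⟨c, hc⟩ : ∃ c : EuclideanSpace ℝ (Fin n) →L[ℝ] W →L[ℝ] W,
      ∀ v ψ, c v ψ = γ (CliffordAlgebra.ι Q v) ψ :=
    ⟨(LinearMap.mk₂ ℝ (fun v ψ => γ (CliffordAlgebra.ι Q v) ψ) (by simp) (by simp) (by simp)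
      (fun r v ψ => LinearMap.map_smul_of_tower _ r ψ)).toContinuousBilinearMap, fun v ψ => rfl⟩
  have hsq (v : EuclideanSpace ℝ (Fin n)) (ψ : W) : c v (c v ψ) = -‖v‖ ^ 2 • ψ := by
    rw [hc, hc, ← Module.End.mul_apply, ← map_mul, CliffordAlgebra.ι_sq_scalar, AlgHom.commutes, hQ,
      Module.algebraMap_end_apply]
  simp only [← hc] at hcompat hG ⊢
  have hn0 : n ≠ 0 := by omega
  have hφ : ContDiff ℝ 1 φ := hφsmooth.of_le (by simp)
  have hφy : ContDiff ℝ 1 fun u => φ (u + y) := hφ.comp (contDiff_id.add contDiff_const)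
  have hφys : HasCompactSupport fun u => φ (u + y) :=
    hφsupp.comp_homeomorph (Homeomorph.addRight y)
  have heq (x : EuclideanSpace ℝ (Fin n)) :
      ⟪G x y ψ₀, ∑ i : Fin n, c (EuclideanSpace.single i (1 : ℝ))
        (fderiv ℝ φ x (EuclideanSpace.single i (1 : ℝ)))⟫_ℂ =
      ⟪-(ωn⁻¹ * (‖x - y‖ ^ n)⁻¹) • c (x - y) ψ₀,
        diracOp c (fun u => φ (u + y)) (x - y)⟫_ℂ := by
    rw [hG, diracOp_comp_add_right, sub_add_cancel, diracOp]
  simp only [heq]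
  constructor
  · have h := ((integrable_inner_norm_pow_smul_diracOp (c := c) hn0 ψ₀ hφy hφys).smul
      (-ωn⁻¹)).comp_sub_right y
    refine h.congr (.of_forall fun x => ?_)
    simp only [Pi.smul_apply]
    rw [← neg_mul, mul_smul, inner_smul_left_eq_smul _ _ (-ωn⁻¹)]
  · rw [integral_sub_right_eq_self (fun x => ⟪-(ωn⁻¹ * (‖x‖ ^ n)⁻¹) • c x ψ₀,
      diracOp c (fun u => φ (u + y)) x⟫_ℂ) y,
      integral_inner_norm_pow_smul_diracOp hn0 hcompat hsq hωn ψ₀ hφy hφys, zero_add]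
end

section
/- Let n ≥ 2, let W be a complex Clifford module and Φ ∈ W. Define φ^± : ℝⁿ → W by φ^±(x) := (1+‖x‖²)^{-n/2}(Φ ∓ x·Φ). Then D(φ^±)(x) = ± n (1+‖x‖²)^{-1} φ^±(x) for all x ∈ ℝⁿ. -/
/-- Directional derivatives of the field `x ↦ (1 + ‖x‖²)^(-n/2) (Φ + s x·Φ)`, where `c` is a
linear family of endomorphisms. -/
theorem fderiv_conformal_spinor {n : ℕ} {W : Type*} [NormedAddCommGroup W] [NormedSpace ℂ W]
    (c : EuclideanSpace ℝ (Fin n) →ₗ[ℝ] Module.End ℂ W) (s : ℝ) (Φ : W)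
    (x v : EuclideanSpace ℝ (Fin n)) :
    fderiv ℝ (fun y => ((1 + ‖y‖ ^ 2) ^ (-(n : ℝ) / 2)) • (Φ + s • c y Φ)) x v =
      (1 + ‖x‖ ^ 2) ^ (-(n : ℝ) / 2) • s • c v Φ +
        (-(n : ℝ) * (1 + ‖x‖ ^ 2) ^ (-(n : ℝ) / 2) * (1 + ‖x‖ ^ 2)⁻¹ * inner ℝ x v) •
          (Φ + s • c x Φ) := by
  have hpos : 0 < 1 + ‖x‖ ^ 2 := by positivity
  have hf := ((hasStrictFDerivAt_norm_sq x).hasFDerivAt.const_add 1).rpow_const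
    (p := -(n : ℝ) / 2) (Or.inl hpos.ne')
  let L : EuclideanSpace ℝ (Fin n) →L[ℝ] W := LinearMap.toContinuousLinearMap
    { toFun := fun y => c y Φ
      map_add' := by simp
      map_smul' := by simp }
  have hg : HasFDerivAt (fun y => Φ + s • c y Φ) (s • L) x :=
    (L.hasFDerivAt.const_smul s).const_add Φ
  have hL : L v = c v Φ := rfl
  have hfg := (hf.smul hg).fderiv
  simp only [Pi.smul_def'] at hfg
  rw [hfg]
  simp only [add_apply, smul_apply,
    ContinuousLinearMap.smulRight_apply, hL, innerSL_apply_apply, Real.rpow_sub_one hpos.ne',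
    smul_eq_mul, nsmul_eq_mul]
  congr 2
  push_cast
  ring

/-- The Dirac operator of `x ↦ (1 + ‖x‖²)^(-n/2) (Φ + s x·Φ)` for `s² = 1`, where `c` is a
Clifford multiplication. -/
theorem dirac_conformal_spinor {n : ℕ} {W : Type*} [NormedAddCommGroup W] [NormedSpace ℂ W]
    (c : EuclideanSpace ℝ (Fin n) →ₗ[ℝ] Module.End ℂ W)
    (hc : ∀ v w, c v (c v w) = (-‖v‖ ^ 2) • w) {s : ℝ} (hs : s * s = 1) (Φ : W)
    (x : EuclideanSpace ℝ (Fin n)) :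
    ∑ i : Fin n, c (EuclideanSpace.single i (1 : ℝ))
        (fderiv ℝ (fun y => ((1 + ‖y‖ ^ 2) ^ (-(n : ℝ) / 2)) • (Φ + s • c y Φ)) x
          (EuclideanSpace.single i (1 : ℝ))) =
      (-s * n * (1 + ‖x‖ ^ 2)⁻¹) • ((1 + ‖x‖ ^ 2) ^ (-(n : ℝ) / 2)) • (Φ + s • c x Φ) := by
  have hpos : 1 + ‖x‖ ^ 2 ≠ 0 := by positivity
  have hx (w : W) : ∑ i, x i • c (EuclideanSpace.single i (1 : ℝ)) w = c x w := by
    conv_rhs => rw [← (EuclideanSpace.basisFun (Fin n) ℝ).sum_repr x]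
    simp [LinearMap.sum_apply]
  have hsmul (v : EuclideanSpace ℝ (Fin n)) (r : ℝ) (w : W) : c v (r • w) = r • c v w :=
    LinearMap.map_smul_of_tower _ r w
  have hin (i : Fin n) : inner ℝ x (EuclideanSpace.single i (1 : ℝ)) = x i := by
    simp [EuclideanSpace.inner_single_right]
  simp_rw [fderiv_conformal_spinor, map_add, hsmul, hin, hc, mul_smul _ (x.ofLp _),
    Finset.sum_add_distrib]
  simp_rw [← Finset.smul_sum, hx]
  rw [map_add, hsmul, hc]
  simp only [PiLp.norm_single, norm_one, one_pow, Finset.sum_const, Finset.card_univ,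
    Fintype.card_fin, ← Nat.cast_smul_eq_nsmul ℝ]
  match_scalars
  · field_simp
    ring
  · field_simp
    linear_combination (n : ℝ) * hs

/-- Let `n ≥ 2`, let `W` be a complex Clifford module (over the Clifford
algebra `Cl_n` of `Q v = -‖v‖²` on `ℝⁿ`) and `Φ ∈ W`.  Define
`φ^±(x) = (1+‖x‖²)^{-n/2}(Φ ∓ x·Φ)`.  Then `D(φ^±)(x) = ± n (1+‖x‖²)⁻¹ φ^±(x)`
for all `x ∈ ℝⁿ`, where `Dφ(x) = Σᵢ eᵢ·∂ᵢφ(x)` is the Euclidean Dirac operator. -/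
theorem stmt_10 (n : ℕ) (hn : 2 ≤ n)
    (Q : QuadraticForm ℝ (EuclideanSpace ℝ (Fin n)))
    (hQ : ∀ v : EuclideanSpace ℝ (Fin n), Q v = -‖v‖ ^ 2)
    (W : Type) [NormedAddCommGroup W] [NormedSpace ℂ W]
    [FiniteDimensional ℂ W] [Nontrivial W]
    (γ : CliffordAlgebra Q →ₐ[ℝ] Module.End ℂ W)
    (Φ : W) (φp φm : EuclideanSpace ℝ (Fin n) → W)
    (hφp : ∀ x : EuclideanSpace ℝ (Fin n),
      φp x = ((1 + ‖x‖ ^ 2) ^ (-(n : ℝ) / 2)) • (Φ - γ (CliffordAlgebra.ι Q x) Φ))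
    (hφm : ∀ x : EuclideanSpace ℝ (Fin n),
      φm x = ((1 + ‖x‖ ^ 2) ^ (-(n : ℝ) / 2)) • (Φ + γ (CliffordAlgebra.ι Q x) Φ)) :
    (∀ x : EuclideanSpace ℝ (Fin n),
      ∑ i : Fin n, γ (CliffordAlgebra.ι Q (EuclideanSpace.single i (1 : ℝ)))
        (fderiv ℝ φp x (EuclideanSpace.single i (1 : ℝ)))
        = ((n : ℝ) * (1 + ‖x‖ ^ 2)⁻¹) • φp x) ∧
    (∀ x : EuclideanSpace ℝ (Fin n),
      ∑ i : Fin n, γ (CliffordAlgebra.ι Q (EuclideanSpace.single i (1 : ℝ)))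
        (fderiv ℝ φm x (EuclideanSpace.single i (1 : ℝ)))
        = (-(n : ℝ) * (1 + ‖x‖ ^ 2)⁻¹) • φm x) := by
  have hc (v : EuclideanSpace ℝ (Fin n)) (w : W) :
      (γ.toLinearMap ∘ₗ CliffordAlgebra.ι Q) v ((γ.toLinearMap ∘ₗ CliffordAlgebra.ι Q) v w) =
        (-‖v‖ ^ 2) • w := by
    simp only [LinearMap.comp_apply, AlgHom.toLinearMap_apply]
    rw [← Module.End.mul_apply, ← map_mul, CliffordAlgebra.ι_sq_scalar, hQ, AlgHom.commutes,
      Module.algebraMap_end_apply]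
  obtain rfl : φp = _ := funext hφp
  obtain rfl : φm = _ := funext hφm
  refine ⟨fun x => ?_, fun x => ?_⟩
  · simpa [sub_eq_add_neg] using dirac_conformal_spinor _ hc (s := -1) (by norm_num) Φ x
  · simpa using dirac_conformal_spinor _ hc (s := 1) (by norm_num) Φ x
end

section
/- Let n ≥ 2, let W be a complex Clifford module equipped with a compatible Hermitian inner product, and let Φ ∈ W with Φ ≠ 0. Define φ⁺ : ℝⁿ → W by φ⁺(x) := (1+‖x‖²)^{-n/2}(Φ - x·Φ), and Dφ⁺(x) = Σ_i e_i·∂_i φ⁺(x). Then ∫_{ℝⁿ} Re⟨Dφ⁺(x), φ⁺(x)⟩ dx > 0 and (∫_{ℝⁿ} ‖Dφ⁺(x)‖^{2n/(n+1)} dx)^{(n+1)/n} / ∫_{ℝⁿ} Re⟨Dφ⁺(x), φ⁺(x)⟩ dx = (n/2)·ω_n^{1/n}, where ω_n := 2π^{(n+1)/2}/Γ((n+1)/2). -/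
open scoped InnerProductSpace
open MeasureTheory Set

section RadialIntegral

variable {V : Type*} [NormedAddCommGroup V] [InnerProductSpace ℝ V] [FiniteDimensional ℝ V]
  [MeasurableSpace V] [BorelSpace V]

lemma integrable_one_add_norm_sq_rpow_neg {a : ℝ} (ha : (Module.finrank ℝ V : ℝ) / 2 < a) :
    Integrable (fun x : V => (1 + ‖x‖ ^ 2) ^ (-a)) := by
  have h := integrable_rpow_neg_one_add_norm_sq (E := V) (μ := volume) (r := 2 * a) (by linarith)
  refine h.congr (.of_forall fun x => ?_)
  dsimp only
  congr 1
  ring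

lemma integral_one_add_norm_sq_rpow_neg {a : ℝ} (ha : (Module.finrank ℝ V : ℝ) / 2 < a) :
    ∫ x : V, (1 + ‖x‖ ^ 2) ^ (-a)
      = Real.pi ^ ((Module.finrank ℝ V : ℝ) / 2)
        * Real.Gamma (a - (Module.finrank ℝ V : ℝ) / 2) / Real.Gamma a := by
  have ha0 : 0 < a := lt_of_le_of_lt (by positivity) ha
  have hΓ := Real.Gamma_pos_of_pos ha0
  set F : V → ℝ → ℝ := fun x t => t ^ (a - 1) * Real.exp (-((1 + ‖x‖ ^ 2) * t)) with hF
  have hFint (x : V) : ∫ t in Ioi 0, F x t = (1 + ‖x‖ ^ 2) ^ (-a) * Real.Gamma a := by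
    rw [Real.integral_rpow_mul_exp_neg_mul_Ioi ha0 (by positivity), one_div,
      Real.inv_rpow (by positivity), Real.rpow_neg (by positivity)]
  have hmeas : AEStronglyMeasurable (Function.uncurry F)
      ((volume : Measure V).prod (volume.restrict (Ioi (0 : ℝ)))) := by
    refine Measurable.aestronglyMeasurable ?_
    simp only [hF, Function.uncurry_def]
    fun_prop
  have hint : Integrable (Function.uncurry F)
      ((volume : Measure V).prod (volume.restrict (Ioi (0 : ℝ)))) := by
    refine (integrable_prod_iff hmeas).2 ⟨.of_forall fun x => ?_, ?_⟩
    · refine Integrable.of_integral_ne_zero ?_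
      rw [show (fun y => Function.uncurry F (x, y)) = F x from rfl, hFint]
      positivity
    · refine ((integrable_one_add_norm_sq_rpow_neg ha).mul_const (Real.Gamma a)).congr
        (.of_forall fun x => ?_)
      dsimp only
      rw [← hFint]
      refine setIntegral_congr_fun measurableSet_Ioi fun t ht => ?_
      have ht' : (0 : ℝ) < t := ht
      simp only [Function.uncurry, hF]
      rw [Real.norm_of_nonneg (by positivity)]
  have hswap := integral_integral_swap hint
  simp only [hFint] at hswap
  rw [integral_mul_const] at hswap
  rw [eq_div_iff hΓ.ne', hswap]
  have hinner : ∀ t ∈ Ioi (0 : ℝ), ∫ x : V, F x t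
      = Real.pi ^ ((Module.finrank ℝ V : ℝ) / 2)
        * (t ^ (a - (Module.finrank ℝ V : ℝ) / 2 - 1) * Real.exp (-(1 * t))) := by
    intro t ht
    have ht' : (0 : ℝ) < t := ht
    have h : ∀ x : V, F x t = t ^ (a - 1) * Real.exp (-t) * Real.exp (-t * ‖x‖ ^ 2) := by
      intro x
      rw [mul_assoc, ← Real.exp_add]
      simp only [hF]
      ring_nf
    simp only [h]
    rw [integral_const_mul, GaussianFourier.integral_rexp_neg_mul_sq_norm ht',
      Real.div_rpow Real.pi_pos.le ht'.le, one_mul,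
      show a - (Module.finrank ℝ V : ℝ) / 2 - 1 = (a - 1) - (Module.finrank ℝ V : ℝ) / 2 by ring,
      Real.rpow_sub ht' (a - 1)]
    ring
  rw [setIntegral_congr_fun measurableSet_Ioi hinner, integral_const_mul,
    Real.integral_rpow_mul_exp_neg_mul_Ioi (by linarith) one_pos]
  simp

end RadialIntegral

/-- Stereographic projection computes the volume of the sphere `Sⁿ`. -/
lemma integral_one_add_norm_sq_rpow_neg_dim {n : ℕ} (hn : 0 < n) :
    ∫ x : EuclideanSpace ℝ (Fin n), (1 + ‖x‖ ^ 2) ^ (-(n : ℝ))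
      = 2 ^ (-(n : ℝ))
        * (2 * Real.pi ^ (((n : ℝ) + 1) / 2) / Real.Gamma (((n : ℝ) + 1) / 2)) := by
  have hn' : (0 : ℝ) < n := by exact_mod_cast hn
  rw [integral_one_add_norm_sq_rpow_neg (by simpa using hn'), finrank_euclideanSpace_fin]
  have hdup := Real.Gamma_mul_Gamma_add_half ((n : ℝ) / 2)
  rw [show 2 * ((n : ℝ) / 2) = n by ring, Real.sqrt_eq_rpow,
    show (n : ℝ) / 2 + 1 / 2 = ((n : ℝ) + 1) / 2 by ring, sub_eq_add_neg,
    Real.rpow_add two_pos, Real.rpow_one] at hdup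
  have h1 := Real.Gamma_pos_of_pos hn'
  have h2 := Real.Gamma_pos_of_pos (show 0 < ((n : ℝ) + 1) / 2 by positivity)
  rw [sub_half, add_div, Real.rpow_add Real.pi_pos, ← mul_div_assoc,
    div_eq_div_iff h1.ne' (by rw [← add_div]; exact h2.ne'), ← add_div, mul_assoc, hdup]
  ring

section CliffordModule

variable {E : Type*} [NormedAddCommGroup E] [InnerProductSpace ℝ E]
  {W : Type*} [NormedAddCommGroup W] [InnerProductSpace ℂ W]
  {Q : QuadraticForm ℝ E} (γ : CliffordAlgebra Q →ₐ[ℝ] Module.End ℂ W)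

lemma clifford_smul_smul (hQ : ∀ v : E, Q v = -‖v‖ ^ 2) (v : E) (ψ : W) :
    γ (CliffordAlgebra.ι Q v) (γ (CliffordAlgebra.ι Q v) ψ) = (-‖v‖ ^ 2 : ℝ) • ψ := by
  rw [← Module.End.mul_apply, ← map_mul, CliffordAlgebra.ι_sq_scalar, AlgHom.commutes, hQ,
    Module.algebraMap_end_apply]

lemma norm_sq_sub_clifford_smul (hQ : ∀ v : E, Q v = -‖v‖ ^ 2)
    (hcompat : ∀ (v : E) (φ ψ : W),
      ⟪γ (CliffordAlgebra.ι Q v) φ, ψ⟫_ℂ = -⟪φ, γ (CliffordAlgebra.ι Q v) ψ⟫_ℂ)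
    (v : E) (Φ : W) :
    ‖Φ - γ (CliffordAlgebra.ι Q v) Φ‖ ^ 2 = (1 + ‖v‖ ^ 2) * ‖Φ‖ ^ 2 := by
  have hre : (⟪Φ, γ (CliffordAlgebra.ι Q v) Φ⟫_ℂ).re = 0 := by
    have h := congrArg Complex.re (hcompat v Φ Φ)
    have h' := inner_re_symm (𝕜 := ℂ) Φ (γ (CliffordAlgebra.ι Q v) Φ)
    simp only [Complex.neg_re, RCLike.re_to_complex] at h h'
    linarith
  have hsq : ‖γ (CliffordAlgebra.ι Q v) Φ‖ ^ 2 = ‖v‖ ^ 2 * ‖Φ‖ ^ 2 := by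
    have h := congrArg Complex.re (hcompat v Φ (γ (CliffordAlgebra.ι Q v) Φ))
    rw [clifford_smul_smul γ hQ, inner_smul_right_eq_smul, Complex.neg_re, Complex.smul_re,
      ← RCLike.re_to_complex, ← RCLike.re_to_complex, inner_self_eq_norm_sq,
      inner_self_eq_norm_sq, smul_eq_mul] at h
    linarith
  rw [norm_sub_sq (𝕜 := ℂ), hsq, RCLike.re_to_complex, hre]
  ring

variable [FiniteDimensional ℝ E]

/-- Clifford multiplication on a fixed spinor, as a continuous linear map. -/
noncomputable def cliffordOrbit (Φ : W) : E →L[ℝ] W :=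
  LinearMap.toContinuousLinearMap
    { toFun := fun v => γ (CliffordAlgebra.ι Q v) Φ
      map_add' := fun v w => by simp
      map_smul' := fun c v => by simp }

@[simp]
lemma cliffordOrbit_apply (Φ : W) (v : E) :
    cliffordOrbit γ Φ v = γ (CliffordAlgebra.ι Q v) Φ := rfl

lemma fderiv_rpow_smul_sub_clifford_smul (p : ℝ) (Φ : W) (x v : E) :
    fderiv ℝ (fun y : E => ((1 + ‖y‖ ^ 2) ^ p) • (Φ - γ (CliffordAlgebra.ι Q y) Φ)) x v
      = (2 * p * (1 + ‖x‖ ^ 2) ^ (p - 1) * ⟪x, v⟫_ℝ) • (Φ - γ (CliffordAlgebra.ι Q x) Φ)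
        - ((1 + ‖x‖ ^ 2) ^ p) • γ (CliffordAlgebra.ι Q v) Φ := by
  have hs : (1 + ‖x‖ ^ 2) ≠ 0 := by positivity
  have h1 : HasFDerivAt (fun y : E => (1 + ‖y‖ ^ 2) ^ p) _ x :=
    ((hasStrictFDerivAt_norm_sq x).hasFDerivAt.const_add 1).rpow_const (p := p) (.inl hs)
  have h2 : HasFDerivAt (fun y : E => Φ - cliffordOrbit γ Φ y) _ x :=
    (cliffordOrbit γ Φ).hasFDerivAt.const_sub Φ
  have h := h1.smul h2
  simp only [cliffordOrbit_apply] at h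
  refine (congrArg (· v) h.fderiv).trans ?_
  simp
  module

end CliffordModule

lemma dirac_rpow_smul_sub_clifford_smul {n : ℕ}
    {Q : QuadraticForm ℝ (EuclideanSpace ℝ (Fin n))}
    (hQ : ∀ v : EuclideanSpace ℝ (Fin n), Q v = -‖v‖ ^ 2)
    {W : Type*} [NormedAddCommGroup W] [InnerProductSpace ℂ W]
    (γ : CliffordAlgebra Q →ₐ[ℝ] Module.End ℂ W) (Φ : W) (x : EuclideanSpace ℝ (Fin n)) :
    ∑ i : Fin n, γ (CliffordAlgebra.ι Q (EuclideanSpace.single i (1 : ℝ)))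
        (fderiv ℝ (fun y : EuclideanSpace ℝ (Fin n) =>
          ((1 + ‖y‖ ^ 2) ^ (-(n : ℝ) / 2)) • (Φ - γ (CliffordAlgebra.ι Q y) Φ)) x
          (EuclideanSpace.single i (1 : ℝ)))
      = (n * (1 + ‖x‖ ^ 2) ^ (-(n : ℝ) / 2 - 1)) • (Φ - γ (CliffordAlgebra.ι Q x) Φ) := by
  set s := (1 + ‖x‖ ^ 2) with hs
  have hs0 : 0 < s := by positivity
  have hsum : ∀ ψ : W, ∑ i : Fin n,
      x i • γ (CliffordAlgebra.ι Q (EuclideanSpace.single i (1 : ℝ))) ψ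
        = γ (CliffordAlgebra.ι Q x) ψ := by
    intro ψ
    have hx := (EuclideanSpace.basisFun (Fin n) ℝ).sum_repr x
    simp only [EuclideanSpace.basisFun_repr, EuclideanSpace.basisFun_apply] at hx
    conv_rhs => rw [← hx]
    simp
  have hterm : ∀ i : Fin n, γ (CliffordAlgebra.ι Q (EuclideanSpace.single i (1 : ℝ)))
        (fderiv ℝ (fun y : EuclideanSpace ℝ (Fin n) =>
          ((1 + ‖y‖ ^ 2) ^ (-(n : ℝ) / 2)) • (Φ - γ (CliffordAlgebra.ι Q y) Φ)) x
          (EuclideanSpace.single i (1 : ℝ)))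
      = (-n * s ^ (-(n : ℝ) / 2 - 1)) •
          (x i • γ (CliffordAlgebra.ι Q (EuclideanSpace.single i (1 : ℝ)))
            (Φ - γ (CliffordAlgebra.ι Q x) Φ))
        + s ^ (-(n : ℝ) / 2) • Φ := by
    intro i
    rw [fderiv_rpow_smul_sub_clifford_smul, map_sub, LinearMap.map_smul_of_tower,
      LinearMap.map_smul_of_tower, clifford_smul_smul γ hQ, EuclideanSpace.inner_single_right,
      smul_smul, smul_smul, sub_eq_add_neg _ (_ • Φ), ← neg_smul]
    congr 2
    · simp only [conj_trivial]
      ring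
    · simp [hs]
  rw [Finset.sum_congr rfl fun i _ => hterm i, Finset.sum_add_distrib, ← Finset.smul_sum, hsum,
    map_sub, clifford_smul_smul γ hQ, Finset.sum_const, Finset.card_univ, Fintype.card_fin,
    Real.rpow_sub_one hs0.ne', ← Nat.cast_smul_eq_nsmul ℝ]
  match_scalars
  · ring
  · field_simp
    rw [hs]
    ring

/-- Let `n ≥ 2`, let `W` be a complex Clifford module (over the Clifford
algebra `Cl_n` of `Q v = -‖v‖²` on `ℝⁿ`) with a compatible Hermitian inner product,
and let `Φ ∈ W`, `Φ ≠ 0`.  For `φ⁺(x) = (1+‖x‖²)^{-n/2}(Φ - x·Φ)` and the Euclidean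
Dirac operator `Dφ⁺(x) = Σᵢ eᵢ·∂ᵢφ⁺(x)` one has `∫ Re⟨Dφ⁺, φ⁺⟩ > 0` and
`(∫ ‖Dφ⁺‖^{2n/(n+1)})^{(n+1)/n} / ∫ Re⟨Dφ⁺, φ⁺⟩ = (n/2)·ω_n^{1/n}` with
`ω_n = 2π^{(n+1)/2}/Γ((n+1)/2)`. -/
theorem stmt_13 (n : ℕ) (hn : 2 ≤ n)
    (Q : QuadraticForm ℝ (EuclideanSpace ℝ (Fin n)))
    (hQ : ∀ v : EuclideanSpace ℝ (Fin n), Q v = -‖v‖ ^ 2)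
    (W : Type) [NormedAddCommGroup W] [InnerProductSpace ℂ W]
    [FiniteDimensional ℂ W] [Nontrivial W]
    (γ : CliffordAlgebra Q →ₐ[ℝ] Module.End ℂ W)
    (hcompat : ∀ (v : EuclideanSpace ℝ (Fin n)) (φ ψ : W),
      ⟪γ (CliffordAlgebra.ι Q v) φ, ψ⟫_ℂ = -⟪φ, γ (CliffordAlgebra.ι Q v) ψ⟫_ℂ)
    (Φ : W) (hΦ : Φ ≠ 0)
    (φ : EuclideanSpace ℝ (Fin n) → W)
    (hφ : ∀ x : EuclideanSpace ℝ (Fin n),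
      φ x = ((1 + ‖x‖ ^ 2) ^ (-(n : ℝ) / 2)) • (Φ - γ (CliffordAlgebra.ι Q x) Φ))
    (Dφ : EuclideanSpace ℝ (Fin n) → W)
    (hDφ : ∀ x : EuclideanSpace ℝ (Fin n),
      Dφ x = ∑ i : Fin n, γ (CliffordAlgebra.ι Q (EuclideanSpace.single i (1 : ℝ)))
        (fderiv ℝ φ x (EuclideanSpace.single i (1 : ℝ))))
    (ωn : ℝ) (hωn : ωn = 2 * Real.pi ^ (((n : ℝ) + 1) / 2) / Real.Gamma (((n : ℝ) + 1) / 2)) :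
    (0 < ∫ x : EuclideanSpace ℝ (Fin n), (⟪Dφ x, φ x⟫_ℂ).re) ∧
    (∫ x : EuclideanSpace ℝ (Fin n), ‖Dφ x‖ ^ (2 * (n : ℝ) / ((n : ℝ) + 1)))
        ^ (((n : ℝ) + 1) / (n : ℝ))
      / (∫ x : EuclideanSpace ℝ (Fin n), (⟪Dφ x, φ x⟫_ℂ).re)
      = ((n : ℝ) / 2) * ωn ^ ((1 : ℝ) / (n : ℝ)) := by
  have hn0 : (0 : ℝ) < n := by exact_mod_cast (by omega : 0 < n)
  have hΦ0 : 0 < ‖Φ‖ := norm_pos_iff.2 hΦ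
  obtain rfl : φ = _ := funext hφ
  have hD : ∀ x, Dφ x = (n * (1 + ‖x‖ ^ 2) ^ (-(n : ℝ) / 2 - 1)) •
      (Φ - γ (CliffordAlgebra.ι Q x) Φ) := fun x => by
    rw [hDφ, dirac_rpow_smul_sub_clifford_smul hQ]
  have hinner : ∀ x, (⟪Dφ x, ((1 + ‖x‖ ^ 2) ^ (-(n : ℝ) / 2)) •
      (Φ - γ (CliffordAlgebra.ι Q x) Φ)⟫_ℂ).re
        = n * ‖Φ‖ ^ 2 * (1 + ‖x‖ ^ 2) ^ (-(n : ℝ)) := fun x => by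
    have hs : 0 < 1 + ‖x‖ ^ 2 := by positivity
    rw [hD, inner_smul_left_eq_smul, inner_smul_right_eq_smul, Complex.smul_re, Complex.smul_re,
      ← RCLike.re_to_complex, inner_self_eq_norm_sq, norm_sq_sub_clifford_smul γ hQ hcompat, Real.rpow_sub_one hs.ne',
      show -(n : ℝ) = -(n : ℝ) / 2 + -(n : ℝ) / 2 by ring, Real.rpow_add hs]
    simp only [smul_eq_mul]
    field_simp
    ring_nf
  have hnorm : ∀ x, ‖Dφ x‖ ^ (2 * (n : ℝ) / ((n : ℝ) + 1))
      = (n * ‖Φ‖) ^ (2 * (n : ℝ) / ((n : ℝ) + 1)) * (1 + ‖x‖ ^ 2) ^ (-(n : ℝ)) := fun x => by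
    have hs : 0 < 1 + ‖x‖ ^ 2 := by positivity
    have h : ‖Dφ x‖ = n * ‖Φ‖ * (1 + ‖x‖ ^ 2) ^ (-((n : ℝ) + 1) / 2) := by
      rw [← sq_eq_sq₀ (norm_nonneg _) (by positivity), hD, norm_smul, mul_pow,
        norm_sq_sub_clifford_smul γ hQ hcompat, Real.norm_of_nonneg (by positivity),
        show -(n : ℝ) / 2 - 1 = -((n : ℝ) + 1) / 2 + -(1 / 2) by ring, Real.rpow_add hs,
        mul_pow, mul_pow, mul_pow, mul_pow, ← Real.rpow_mul_natCast hs.le (-(1 / 2)),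
        show -(1 / 2) * ((2 : ℕ) : ℝ) = -1 by norm_num, Real.rpow_neg_one]
      field_simp
    rw [h, Real.mul_rpow (by positivity) (by positivity), ← Real.rpow_mul hs.le]
    congr 2
    field_simp
  have hω : 0 < ωn := by
    rw [hωn]
    have := Real.Gamma_pos_of_pos (show 0 < ((n : ℝ) + 1) / 2 by positivity)
    positivity
  simp only [hinner, hnorm, integral_const_mul]
  rw [integral_one_add_norm_sq_rpow_neg_dim (by omega), ← hωn]
  refine ⟨by positivity, ?_⟩
  have hI : 0 < 2 ^ (-(n : ℝ)) * ωn := by positivity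
  rw [Real.mul_rpow (by positivity) hI.le, ← Real.rpow_mul (by positivity),
    show 2 * (n : ℝ) / (n + 1) * ((n + 1) / n) = (2 : ℕ) by push_cast; field_simp,
    Real.rpow_natCast, show ((n : ℝ) + 1) / n = 1 + 1 / n by field_simp, Real.rpow_add hI,
    Real.rpow_one, Real.mul_rpow (z := 1 / (n : ℝ)) (by positivity) hω.le,
    ← Real.rpow_mul two_pos.le, show -(n : ℝ) * (1 / n) = -1 by field_simp, Real.rpow_neg_one]
  field_simp
end
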